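/- Let m be a positive natural number, Λ a symmetric positive definite real m×m matrix, and x : ℝ → ℝ^m a differentiable function. Define s(t) = x'(t) + Λ·x(t). If s is square integrable on [0,∞), i.e. ∫₀^∞ ‖s(t)‖² dt < ∞, then x is bounded on [0,∞). (This is the step 's_x ∈ L₂ leads to Δx ∈ L_∞' in the paper's analysis.) -/

import Mathlib

open Matrix Filter MeasureTheory

/-- The quadratic form of a real positive definite matrix is coercive. -/
theorem Matrix.PosDef.exists_pos_mul_norm_sq_le_inner {n : Type*} [Fintype n] [DecidableEq n]
    {A : Matrix n n ℝ} (hA : A.PosDef) :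
    ∃ c : ℝ, 0 < c ∧ ∀ v : EuclideanSpace ℝ n,
      c * ‖v‖ ^ 2 ≤ inner ℝ v (Matrix.toEuclideanLin A v) := by
  have hpos : ∀ v : EuclideanSpace ℝ n, v ≠ 0 → 0 < inner ℝ v (Matrix.toEuclideanLin A v) := by
    intro v hv
    have h := hA.dotProduct_mulVec_pos (x := v.ofLp) (by simpa using hv)
    rw [EuclideanSpace.inner_eq_star_dotProduct, dotProduct_comm]
    simpa using h
  have hcont : Continuous fun v : EuclideanSpace ℝ n ↦
      inner ℝ v (Matrix.toEuclideanLin A v) :=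
    continuous_id.inner (Matrix.toEuclideanLin A).continuous_of_finiteDimensional
  rcases (Metric.sphere (0 : EuclideanSpace ℝ n) 1).eq_empty_or_nonempty with hemp | hne
  · refine ⟨1, one_pos, fun v ↦ ?_⟩
    have hv : v = 0 := by
      by_contra hv
      have : ‖v‖⁻¹ • v ∈ Metric.sphere (0 : EuclideanSpace ℝ n) 1 := by
        simp [norm_smul, hv]
      simp [hemp] at this
    simp [hv]
  · obtain ⟨u, hu, hmin⟩ := (isCompact_sphere (0 : EuclideanSpace ℝ n) 1).exists_isMinOn hne
      hcont.continuousOn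
    have hu0 : u ≠ 0 := ne_zero_of_mem_unit_sphere ⟨u, hu⟩
    refine ⟨_, hpos u hu0, fun v ↦ ?_⟩
    rcases eq_or_ne v 0 with rfl | hv
    · simp
    have hmem : ‖v‖⁻¹ • v ∈ Metric.sphere (0 : EuclideanSpace ℝ n) 1 := by
      simp [norm_smul, hv]
    have h := isMinOn_iff.1 hmin _ hmem
    simp only [map_smul, inner_smul_left, inner_smul_right] at h
    have hn : 0 < ‖v‖ := norm_pos_iff.2 hv
    calc _ ≤ _ := mul_le_mul_of_nonneg_right h (sq_nonneg ‖v‖)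
      _ = _ := by
        simp only [conj_trivial]
        field_simp

/-- If the sliding variable `s = x' + Λ x` is square integrable on `[0, ∞)`
(with `Λ` symmetric positive definite), then `x` is bounded on `[0, ∞)`. -/
theorem sliding_variable_L2_implies_bounded
    (m : ℕ) (hm : 0 < m)
    (Λ : Matrix (Fin m) (Fin m) ℝ) (hΛ : Λ.PosDef)
    (x : ℝ → EuclideanSpace ℝ (Fin m)) (hx : Differentiable ℝ x)
    (s : ℝ → EuclideanSpace ℝ (Fin m))
    (hs : ∀ t : ℝ, s t = deriv x t + Matrix.toEuclideanLin Λ (x t))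
    (hs_L2 : (∫⁻ t in Set.Ici (0:ℝ), ENNReal.ofReal (‖s t‖ ^ 2)) < ⊤) :
    ∃ C : ℝ, ∀ t : ℝ, 0 ≤ t → ‖x t‖ ≤ C := by
  obtain ⟨c, hc, hcoer⟩ := hΛ.exists_pos_mul_norm_sq_le_inner
  have hmeas : Measurable s := by
    rw [funext hs]
    exact (measurable_deriv x).add
      ((Matrix.toEuclideanLin Λ).continuous_of_finiteDimensional.comp hx.continuous).measurable
  have hint : IntegrableOn (fun t ↦ ‖s t‖ ^ 2 / c) (Set.Ici 0) := by
    refine Integrable.div_const ⟨(hmeas.norm.pow_const 2).aestronglyMeasurable, ?_⟩ c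
    rwa [hasFiniteIntegral_iff_ofReal (ae_of_all _ fun t ↦ sq_nonneg ‖s t‖)]
  have hderiv (t : ℝ) : 2 * inner ℝ (x t) (deriv x t) ≤ ‖s t‖ ^ 2 / c := by
    have h1 := real_inner_le_norm (x t) (s t)
    have h2 := hcoer (x t)
    have h3 : inner ℝ (x t) (s t) =
        inner ℝ (x t) (deriv x t) + inner ℝ (x t) (Matrix.toEuclideanLin Λ (x t)) := by
      rw [hs, inner_add_right]
    rw [le_div_iff₀ hc]
    nlinarith [sq_nonneg (‖s t‖ - c * ‖x t‖), sq_nonneg (c * ‖x t‖)]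
  refine ⟨√(‖x 0‖ ^ 2 + ∫ t in Set.Ici (0 : ℝ), ‖s t‖ ^ 2 / c), fun t ht ↦ ?_⟩
  refine Real.le_sqrt_of_sq_le ?_
  have henergy : ‖x t‖ ^ 2 - ‖x 0‖ ^ 2 ≤ ∫ τ in (0 : ℝ)..t, ‖s τ‖ ^ 2 / c :=
    intervalIntegral.sub_le_integral_of_hasDeriv_right_of_le ht
      (hx.continuous.norm.pow 2).continuousOn
      (fun τ _ ↦ (hx τ).hasDerivAt.norm_sq.hasDerivWithinAt)
      (hint.mono_set Set.Icc_subset_Ici_self) (fun τ _ ↦ hderiv τ)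
  have hmono : ∫ τ in (0 : ℝ)..t, ‖s τ‖ ^ 2 / c ≤ ∫ τ in Set.Ici (0 : ℝ), ‖s τ‖ ^ 2 / c := by
    rw [intervalIntegral.integral_of_le ht]
    exact setIntegral_mono_set hint (ae_of_all _ fun τ ↦ by positivity)
      (Set.Ioc_subset_Icc_self.trans Set.Icc_subset_Ici_self).eventuallyLE
  linarith
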